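/- Pauli-Z measurement with outcome 1 deletes the measured vertex from a graph state up to Z-corrections on its neighbors: for every simple graph G on Fin n (n ≥ 1), every vertex q : Fin n, and every x : Fin n → Fin 2 with x(q) = 1, the amplitude of |G⟩ at x equals 2^{-1/2} · (-1)^{k} times the amplitude of |G − q⟩ at the restriction of x to the remaining n−1 coordinates, where k is the number of neighbors u of q in G with x(u) = 1. -/

import Mathlib

open scoped Classical

/-- The phase contributed by a CZ gate on the (unordered) pair of qubits `e`,
at computational-basis index `x`: `(-1)^(x u * x v)`. -/
noncomputable def czPhase {V : Type*} (x : V → Fin 2) (e : Sym2 V) : ℂ :=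
  Sym2.lift ⟨fun u v => (-1 : ℂ) ^ ((x u : ℕ) * (x v : ℕ)),
    fun u v => by simp [Nat.mul_comm]⟩ e

/-- The graph state `|G⟩` of a simple graph `G` on a finite vertex type, as an
amplitude function on computational-basis indices: it is obtained by applying the
(commuting, diagonal) CZ gates of all edges of `G` to the uniform `|+⟩^{⊗n}` state,
whose every amplitude is `2^(-n/2) = (√2)⁻¹ ^ n`. -/
noncomputable def graphState {V : Type*} [Fintype V] (G : SimpleGraph V)
    (x : V → Fin 2) : ℂ :=
  (∏ e ∈ G.edgeFinset, czPhase x e) * (((Real.sqrt 2 : ℝ) : ℂ))⁻¹ ^ (Fintype.card V)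


/-- `G.deleteVertex q` is the induced subgraph of `G` on the vertices other than `q`,
relabeled along the unique monotone bijection `Fin.succAbove q` between
`Fin (n+1) \ {q}` and `Fin n`. -/
def SimpleGraph.deleteVertex {n : ℕ} (G : SimpleGraph (Fin (n + 1))) (q : Fin (n + 1)) :
    SimpleGraph (Fin n) :=
  G.comap q.succAbove

@[simp]
theorem czPhase_mk {V : Type*} (x : V → Fin 2) (u v : V) :
    czPhase x s(u, v) = (-1 : ℂ) ^ ((x u : ℕ) * (x v : ℕ)) := rfl

theorem czPhase_map {V W : Type*} (f : W → V) (x : V → Fin 2) (e : Sym2 W) :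
    czPhase x (e.map f) = czPhase (x ∘ f) e := by
  induction e with
  | h u v => rfl

/-- The CZ gates incident to a qubit in state `1` act as Z gates on its neighbors. -/
theorem prod_czPhase_incident {V : Type*} [Fintype V] (G : SimpleGraph V) (q : V)
    (x : V → Fin 2) (hx : x q = 1) :
    ∏ e ∈ G.edgeFinset with q ∈ e, czPhase x e =
      (-1 : ℂ) ^ ((G.neighborFinset q).filter fun u => x u = 1).card := by
  have himage : (G.edgeFinset.filter fun e => q ∈ e) =
      (G.neighborFinset q).image fun u => s(q, u) := by
    ext e
    induction e with
    | h u v =>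
      simp only [Finset.mem_filter, SimpleGraph.mem_edgeFinset, SimpleGraph.mem_edgeSet,
        Sym2.mem_iff, Finset.mem_image, SimpleGraph.mem_neighborFinset, Sym2.eq_iff]
      constructor
      · rintro ⟨h, rfl | rfl⟩
        · exact ⟨v, h, Or.inl ⟨rfl, rfl⟩⟩
        · exact ⟨u, h.symm, Or.inr ⟨rfl, rfl⟩⟩
      · rintro ⟨w, h, ⟨rfl, rfl⟩ | ⟨rfl, rfl⟩⟩
        · exact ⟨h, Or.inl rfl⟩
        · exact ⟨h.symm, Or.inr rfl⟩
  rw [himage, Finset.prod_image fun u _ v _ h => Sym2.congr_right.mp h,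
    ← Finset.prod_const, Finset.prod_filter]
  refine Finset.prod_congr rfl fun u _ => ?_
  rw [czPhase_mk, hx]
  generalize x u = b
  fin_cases b <;> simp

/-- The edges of `G` avoiding `q` are the edges of `G - q`. -/
theorem SimpleGraph.filter_notMem_edgeFinset {n : ℕ} (G : SimpleGraph (Fin (n + 1)))
    (q : Fin (n + 1)) :
    (G.edgeFinset.filter fun e => q ∉ e) =
      (G.deleteVertex q).edgeFinset.image (Sym2.map q.succAbove) := by
  ext e
  simp only [Finset.mem_filter, Finset.mem_image, SimpleGraph.mem_edgeFinset]
  constructor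
  · induction e with
    | h u v =>
      rintro ⟨h, hq⟩
      rw [Sym2.mem_iff, not_or] at hq
      obtain ⟨u, rfl⟩ := Fin.exists_succAbove_eq (Ne.symm hq.1)
      obtain ⟨v, rfl⟩ := Fin.exists_succAbove_eq (Ne.symm hq.2)
      exact ⟨s(u, v), h, rfl⟩
  · rintro ⟨e, h, rfl⟩
    induction e with
    | h u v =>
      refine ⟨h, ?_⟩
      simp [Fin.ne_succAbove]

/-- Pauli-Z measurement with outcome `1` deletes the measured vertex up to
Z-corrections on its neighbors: if `x q = 1`, the amplitude of `|G⟩` at `x` equals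
`2^(-1/2) · (-1)^k` times the amplitude of `|G − q⟩` at the restriction of `x`,
where `k` is the number of neighbors `u` of `q` in `G` with `x u = 1`. -/
theorem graphState_measureZ_one (n : ℕ) (G : SimpleGraph (Fin (n + 1)))
    (q : Fin (n + 1)) (x : Fin (n + 1) → Fin 2) (hx : x q = 1) :
    graphState G x =
      (((Real.sqrt 2 : ℝ) : ℂ))⁻¹ *
        (-1 : ℂ) ^ (((G.neighborFinset q).filter fun u => x u = 1).card) *
        graphState (G.deleteVertex q) (x ∘ q.succAbove) := by
  have hprod : ∏ e ∈ G.edgeFinset, czPhase x e =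
      (-1 : ℂ) ^ ((G.neighborFinset q).filter fun u => x u = 1).card *
        ∏ e ∈ (G.deleteVertex q).edgeFinset, czPhase (x ∘ q.succAbove) e := by
    rw [← Finset.prod_filter_mul_prod_filter_not G.edgeFinset (fun e => q ∈ e)]
    congr 1
    · convert prod_czPhase_incident G q x hx
    · simp only [← czPhase_map]
      rw [← Finset.prod_image fun _ _ _ _ h =>
        Sym2.map.injective Fin.succAbove_right_injective h]
      convert rfl using 2
      convert (G.filter_notMem_edgeFinset q).symm
  unfold graphState
  rw [hprod, Fintype.card_fin, Fintype.card_fin, pow_succ]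
  ring
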